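/- arXiv:2405.07738 — 4 statements merged into one kernel-verified Lean document; each statement's English description precedes it below -/
import Mathlib

section
/- For every δ > 0 and every t ≥ 0, the tail of the Szász–Mirak'jan elementary functions vanishes: lim_{n→∞} ∑_{k∈ℕ, |k/n − t| ≥ δ} e^{−nt} (nt)^k / k! = 0. -/
open Filter Topology

lemma hasSum_natCast_mul_pow_div_factorial {c : ℕ → ℝ} {x s : ℝ}
    (h : HasSum (fun k : ℕ => c (k + 1) * (x ^ k / (Nat.factorial k : ℝ))) s) :
    HasSum (fun k : ℕ => (k : ℝ) * c k * (x ^ k / (Nat.factorial k : ℝ))) (x * s) := by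
  rw [← hasSum_nat_add_iff' 1]
  simp only [Finset.range_one, Finset.sum_singleton, Nat.cast_zero, zero_mul, sub_zero]
  refine (h.mul_left x).congr_fun fun k => ?_
  rw [Nat.factorial_succ]
  push_cast
  field_simp
  ring

/-- The variance of the Poisson distribution with parameter `x`. -/
lemma hasSum_poisson_sq_sub (x : ℝ) :
    HasSum (fun k : ℕ => Real.exp (-x) * x ^ k / (Nat.factorial k : ℝ) * ((k : ℝ) - x) ^ 2) x := by
  have h₀ : HasSum (fun k : ℕ => x ^ k / (Nat.factorial k : ℝ)) (Real.exp x) := by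
    rw [Real.exp_eq_exp_ℝ]
    exact NormedSpace.expSeries_div_hasSum_exp x
  have h₁ : HasSum (fun k : ℕ => (k : ℝ) * 1 * (x ^ k / (Nat.factorial k : ℝ)))
      (x * Real.exp x) :=
    hasSum_natCast_mul_pow_div_factorial (c := fun _ => 1) (by simpa using h₀)
  have h₂ : HasSum (fun k : ℕ => (k : ℝ) * k * (x ^ k / (Nat.factorial k : ℝ)))
      (x * (x * Real.exp x + Real.exp x)) :=
    hasSum_natCast_mul_pow_div_factorial (c := fun k => (k : ℝ))
      ((h₁.add h₀).congr_fun fun k => by push_cast; ring)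
  have h := ((h₂.sub (h₁.mul_left (2 * x))).add (h₀.mul_left (x ^ 2))).mul_left (Real.exp (-x))
  have hexp : Real.exp (-x) * Real.exp x = 1 := by rw [← Real.exp_add]; simp
  have hx : Real.exp (-x) * (x * (x * Real.exp x + Real.exp x) - 2 * x * (x * Real.exp x)
      + x ^ 2 * Real.exp x) = x := by
    linear_combination x * hexp
  rw [hx] at h
  exact h.congr_fun fun k => by ring

/-- For every `δ > 0` and every `t ≥ 0`, the tail of the
Szász–Mirak'jan elementary functions vanishes:
`lim_{n→∞} ∑_{k : |k/n − t| ≥ δ} e^{−nt} (nt)^k / k! = 0`. -/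
theorem stmt_11 (δ : ℝ) (hδ : 0 < δ) (t : ℝ) (ht : 0 ≤ t) :
    Tendsto (fun n : ℕ+ =>
        ∑' k : ℕ, if δ ≤ |(k : ℝ) / ((n : ℕ) : ℝ) - t| then
            Real.exp (-(((n : ℕ) : ℝ) * t)) * (((n : ℕ) : ℝ) * t) ^ k / (Nat.factorial k : ℝ)
          else 0)
      atTop (𝓝 0) := by
  have hlim : Tendsto (fun n : ℕ+ => t / δ ^ 2 / ((n : ℕ) : ℝ)) atTop (𝓝 0) :=
    (tendsto_const_div_atTop_nhds_zero_nat (t / δ ^ 2)).comp tendsto_PNat_val_atTop_atTop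
  refine squeeze_zero (fun n => tsum_nonneg fun k => by split_ifs <;> positivity) (fun n => ?_) hlim
  have hn : (0 : ℝ) < ((n : ℕ) : ℝ) := by exact_mod_cast n.pos
  have hs := (hasSum_poisson_sq_sub (((n : ℕ) : ℝ) * t)).div_const ((((n : ℕ) : ℝ) * δ) ^ 2)
  have hval : ((n : ℕ) : ℝ) * t / (((n : ℕ) : ℝ) * δ) ^ 2 = t / δ ^ 2 / ((n : ℕ) : ℝ) := by
    field_simp
  rw [hval] at hs
  have hle : ∀ k : ℕ, (if δ ≤ |(k : ℝ) / ((n : ℕ) : ℝ) - t| then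
        Real.exp (-(((n : ℕ) : ℝ) * t)) * (((n : ℕ) : ℝ) * t) ^ k / (Nat.factorial k : ℝ)
      else 0) ≤ Real.exp (-(((n : ℕ) : ℝ) * t)) * (((n : ℕ) : ℝ) * t) ^ k / (Nat.factorial k : ℝ)
        * ((k : ℝ) - ((n : ℕ) : ℝ) * t) ^ 2 / (((n : ℕ) : ℝ) * δ) ^ 2 := fun k => by
    split_ifs with hk
    · rw [mul_div_assoc _ (((k : ℝ) - ((n : ℕ) : ℝ) * t) ^ 2)]
      refine le_mul_of_one_le_right (by positivity) ?_
      rw [one_le_div (by positivity)]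
      have hkn : (k : ℝ) - ((n : ℕ) : ℝ) * t = ((n : ℕ) : ℝ) * ((k : ℝ) / ((n : ℕ) : ℝ) - t) := by
        field_simp
      rw [hkn, mul_pow, mul_pow, ← sq_abs ((k : ℝ) / ((n : ℕ) : ℝ) - t)]
      gcongr
    · positivity
  have hsum := Summable.of_nonneg_of_le (fun k => by split_ifs <;> positivity) hle hs.summable
  exact hasSum_le hle hsum.hasSum hs
end

section
/- For every δ > 0 and every t ≥ 0, the tail of the Baskakov elementary functions vanishes: lim_{n→∞} ∑_{k∈ℕ, |k/n − t| ≥ δ} C(n+k−1, k) · t^k / (1+t)^{n+k} = 0. -/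
open Filter Topology

/-- The Baskakov elementary function `K_{n,k}`. -/
noncomputable def baskakov (n k : ℕ) (t : ℝ) : ℝ :=
  (Nat.choose (n + k - 1) k : ℝ) * t ^ k / (1 + t) ^ (n + k)

theorem baskakov_nonneg (n k : ℕ) {t : ℝ} (ht : 0 ≤ t) : 0 ≤ baskakov n k t := by
  unfold baskakov; positivity

theorem hasSum_baskakov (n : ℕ) {t : ℝ} (ht : 0 ≤ t) :
    HasSum (fun k => baskakov (n + 1) k t) 1 := by
  have h1 : (0 : ℝ) < 1 + t := by positivity
  have hr : ‖t / (1 + t)‖ < 1 := by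
    rw [Real.norm_of_nonneg (by positivity), div_lt_one h1]
    linarith
  have hs : 1 - t / (1 + t) = 1 / (1 + t) := by field_simp; ring
  have h := (hasSum_choose_mul_geometric_of_norm_lt_one n hr).div_const ((1 + t) ^ (n + 1))
  rw [hs] at h
  convert! h using 1
  · ext k
    have hc : (n + 1 + k - 1).choose k = (k + n).choose n := by
      rw [show n + 1 + k - 1 = k + n by lia, Nat.choose_symm_add]
    rw [baskakov, hc, div_pow, pow_add (1 + t) (n + 1) k]
    field_simp
  · rw [div_pow, one_pow]
    field_simp

theorem succ_mul_baskakov_succ (n k : ℕ) {t : ℝ} (ht : 0 ≤ t) :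
    ((k : ℝ) + 1) * baskakov n (k + 1) t = n * t * baskakov (n + 1) k t := by
  have h1 : (0 : ℝ) < 1 + t := by positivity
  have hc : ((n + k).choose (k + 1) : ℝ) * (k + 1) = (n + k).choose k * n := by
    have := Nat.choose_succ_right_eq (n + k) k
    rw [Nat.add_sub_cancel] at this
    exact_mod_cast this
  rw [baskakov, baskakov, show n + (k + 1) - 1 = n + k by lia,
    show n + 1 + k - 1 = n + k by lia, show n + (k + 1) = n + 1 + k by lia]
  field_simp
  linear_combination t ^ (k + 1) * hc

theorem HasSum.mul_baskakov {n : ℕ} {t s : ℝ} (ht : 0 ≤ t) {a : ℕ → ℝ}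
    (h : HasSum (fun k => a (k + 1) * baskakov (n + 1) k t) s) :
    HasSum (fun k : ℕ => k * a k * baskakov n k t) (n * t * s) := by
  rw [← hasSum_nat_add_iff' 1]
  convert! h.mul_left ((n : ℝ) * t) using 1
  · ext k
    push_cast
    linear_combination a (k + 1) * succ_mul_baskakov_succ n k ht
  · simp

theorem hasSum_sq_sub_mul_baskakov (n : ℕ) {t : ℝ} (ht : 0 ≤ t) :
    HasSum (fun k : ℕ => ((k : ℝ) - (n + 1) * t) ^ 2 * baskakov (n + 1) k t)
      ((n + 1) * t * (1 + t)) := by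
  have m0 := hasSum_baskakov n ht
  have m1 : HasSum (fun k : ℕ => k * 1 * baskakov (n + 1) k t) (((n + 1 : ℕ) : ℝ) * t * 1) :=
    HasSum.mul_baskakov ht (a := fun _ => 1) (by simpa using hasSum_baskakov (n + 1) ht)
  have m2 : HasSum (fun k : ℕ => k * ((k : ℝ) - 1) * baskakov (n + 1) k t)
      (((n + 1 : ℕ) : ℝ) * t * (((n + 1 + 1 : ℕ) : ℝ) * t * 1)) := by
    refine HasSum.mul_baskakov ht (a := fun k => (k : ℝ) - 1) ?_
    have := HasSum.mul_baskakov (n := n + 1 + 1) ht (a := fun _ => 1)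
      (by simpa using hasSum_baskakov (n + 1 + 1) ht)
    simpa using this
  convert! (m2.add (m1.mul_left (1 - 2 * (n + 1) * t))).add (m0.mul_left (((n + 1) * t) ^ 2)) using 1
  · ext k; ring
  · push_cast; ring

theorem tsum_baskakov_tail_le (n : ℕ) {δ t : ℝ} (hδ : 0 < δ) (ht : 0 ≤ t) :
    ∑' k : ℕ, (if δ ≤ |(k : ℝ) / ((n + 1 : ℕ) : ℝ) - t| then baskakov (n + 1) k t else 0)
      ≤ t * (1 + t) / δ ^ 2 / ((n + 1 : ℕ) : ℝ) := by
  have h := (hasSum_sq_sub_mul_baskakov n ht).div_const ((δ * (n + 1)) ^ 2)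
  have hn : (0 : ℝ) < n + 1 := by positivity
  have hle : ∀ k : ℕ,
      (if δ ≤ |(k : ℝ) / ((n + 1 : ℕ) : ℝ) - t| then baskakov (n + 1) k t else 0)
        ≤ ((k : ℝ) - (n + 1) * t) ^ 2 * baskakov (n + 1) k t / (δ * (n + 1)) ^ 2 := by
    intro k
    have hb := baskakov_nonneg (n + 1) k ht
    split_ifs with hk
    · rw [le_div_iff₀ (by positivity), mul_comm]
      refine mul_le_mul_of_nonneg_right ?_ hb
      have hsq : δ ^ 2 ≤ ((k : ℝ) / ((n + 1 : ℕ) : ℝ) - t) ^ 2 := by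
        rw [← sq_abs (_ - t)]
        gcongr
      have he : (k : ℝ) - (n + 1) * t = ((k : ℝ) / ((n + 1 : ℕ) : ℝ) - t) * (n + 1) := by
        push_cast
        field_simp
      rw [he, mul_pow, mul_pow]
      gcongr
    · positivity
  have hnn : ∀ k : ℕ,
      0 ≤ if δ ≤ |(k : ℝ) / ((n + 1 : ℕ) : ℝ) - t| then baskakov (n + 1) k t else 0 := by
    intro k
    split_ifs
    exacts [baskakov_nonneg _ _ ht, le_rfl]
  refine ((Summable.of_nonneg_of_le hnn hle h.summable).tsum_le_tsum hle h.summable).trans_eq ?_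
  rw [h.tsum_eq]
  push_cast
  field_simp

/-- For every `δ > 0` and every `t ≥ 0`, the tail of the Baskakov
elementary functions vanishes:
`lim_{n→∞} ∑_{k : |k/n − t| ≥ δ} C(n+k−1, k) t^k / (1+t)^{n+k} = 0`. -/
theorem stmt_12 (δ : ℝ) (hδ : 0 < δ) (t : ℝ) (ht : 0 ≤ t) :
    Tendsto (fun n : ℕ+ =>
        ∑' k : ℕ, if δ ≤ |(k : ℝ) / ((n : ℕ) : ℝ) - t| then
            (Nat.choose ((n : ℕ) + k - 1) k : ℝ) * t ^ k / (1 + t) ^ ((n : ℕ) + k)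
          else 0)
      atTop (𝓝 0) := by
  have hlim : Tendsto (fun n : ℕ+ => t * (1 + t) / δ ^ 2 / ((n : ℕ) : ℝ)) atTop (𝓝 0) :=
    (tendsto_const_div_atTop_nhds_zero_nat _).comp tendsto_PNat_val_atTop_atTop
  refine squeeze_zero (fun n => tsum_nonneg fun k => ?_) (fun n => ?_) hlim
  · split_ifs
    exacts [baskakov_nonneg n k ht, le_rfl]
  · obtain ⟨m, hm⟩ := Nat.exists_eq_succ_of_ne_zero n.ne_zero
    rw [hm]
    exact tsum_baskakov_tail_le m hδ ht
end

section
/- Let f : [0,∞) → ℝ be a bounded function and let t ≥ 0 be a point at which f is continuous. Then the Szász–Mirak'jan operators converge at t: lim_{n→∞} (𝖲_n f)(t) = f(t), where (𝖲_n f)(t) = ∑_{k=0}^∞ f(k/n) e^{−nt} (nt)^k / k!. -/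
open Filter Topology

/-- The Poisson weights sum to one. -/
lemma hasSum_poisson_weight (x : ℝ) :
    HasSum (fun k : ℕ => Real.exp (-x) * x ^ k / (Nat.factorial k : ℝ)) 1 := by
  have h := (NormedSpace.expSeries_div_hasSum_exp x).mul_left (Real.exp (-x))
  rw [← Real.exp_eq_exp_ℝ, ← Real.exp_add, neg_add_cancel, Real.exp_zero] at h
  simpa only [mul_div_assoc] using h

/-- The Stein identity `𝔼[X g(X)] = x 𝔼[g(X + 1)]` for the Poisson distribution of mean `x`. -/
lemma HasSum.poisson_stein {x a : ℝ} {g : ℕ → ℝ}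
    (h : HasSum (fun k : ℕ => g (k + 1) * (Real.exp (-x) * x ^ k / (Nat.factorial k : ℝ))) a) :
    HasSum (fun k : ℕ => (k : ℝ) * g k * (Real.exp (-x) * x ^ k / (Nat.factorial k : ℝ)))
      (x * a) := by
  rw [← hasSum_nat_add_iff' 1]
  convert! h.mul_left x using 1
  · funext k
    have hk : (k : ℝ) + 1 ≠ 0 := by positivity
    have hk' : (Nat.factorial k : ℝ) ≠ 0 := by positivity
    rw [Nat.factorial_succ]
    push_cast
    field_simp
    ring
  · simp

/-- The variance of the Poisson distribution of mean `x` is `x`. -/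
lemma hasSum_poisson_variance (x : ℝ) :
    HasSum (fun k : ℕ => ((k : ℝ) - x) ^ 2 *
      (Real.exp (-x) * x ^ k / (Nat.factorial k : ℝ))) x := by
  have h0 := hasSum_poisson_weight x
  have h1 := HasSum.poisson_stein (x := x) (g := fun _ => 1) (by simpa only [one_mul] using h0)
  have h2 := HasSum.poisson_stein (x := x) (g := fun k => (k : ℝ)) (a := x * 1 + 1) (by
    convert h1.add h0 using 1
    funext k
    push_cast
    ring)
  convert! (h2.sub (h1.mul_left (2 * x))).add (h0.mul_left (x ^ 2)) using 1
  · funext k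
    ring
  · ring

/-- If `f` is bounded on a set and continuous at `t` within it, then `|f s - f t|` is bounded by
an arbitrarily small constant plus a multiple of `(s - t) ^ 2`. -/
lemma ContinuousWithinAt.exists_abs_sub_le_add_sq {f : ℝ → ℝ} {S : Set ℝ} {t C ε : ℝ}
    (hfb : ∀ s ∈ S, |f s| ≤ C) (ht : t ∈ S) (hft : ContinuousWithinAt f S t) (hε : 0 < ε) :
    ∃ D, ∀ s ∈ S, |f s - f t| ≤ ε + D * (s - t) ^ 2 := by
  obtain ⟨δ, hδ, h⟩ := Metric.continuousWithinAt_iff.1 hft ε hε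
  have hC : 0 ≤ C := (abs_nonneg _).trans (hfb t ht)
  refine ⟨2 * C / δ ^ 2, fun s hs => ?_⟩
  rcases lt_or_ge (dist s t) δ with hst | hst
  · have h1 := h hs hst
    rw [Real.dist_eq] at h1
    have : 0 ≤ 2 * C / δ ^ 2 * (s - t) ^ 2 := by positivity
    linarith
  · have h1 : |f s - f t| ≤ 2 * C := by
      linarith [abs_sub (f s) (f t), hfb s hs, hfb t ht]
    have h2 : δ ^ 2 ≤ (s - t) ^ 2 := by
      rw [Real.dist_eq] at hst
      rw [← sq_abs (s - t)]
      gcongr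
    have h3 : 2 * C ≤ 2 * C / δ ^ 2 * (s - t) ^ 2 := by
      rw [div_mul_eq_mul_div, le_div_iff₀ (by positivity)]
      gcongr
    linarith

/-- If `f : [0,∞) → ℝ` is bounded and continuous at `t ≥ 0`, then the
Szász–Mirak'jan operators converge at `t`:
`lim_{n→∞} (𝖲_n f)(t) = f(t)` with `(𝖲_n f)(t) = ∑_k f(k/n) e^{−nt} (nt)^k / k!`. -/
theorem stmt_13 (f : ℝ → ℝ) (hfb : ∃ C, ∀ t ∈ Set.Ici (0 : ℝ), |f t| ≤ C)
    (t : ℝ) (ht : 0 ≤ t) (hft : ContinuousWithinAt f (Set.Ici 0) t) :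
    Tendsto (fun n : ℕ+ =>
        ∑' k : ℕ, f ((k : ℝ) / ((n : ℕ) : ℝ)) *
          (Real.exp (-(((n : ℕ) : ℝ) * t)) * (((n : ℕ) : ℝ) * t) ^ k / (Nat.factorial k : ℝ)))
      atTop (𝓝 (f t)) := by
  obtain ⟨C, hC⟩ := hfb
  rw [Metric.tendsto_nhds]
  intro ε hε
  obtain ⟨D, hD⟩ := hft.exists_abs_sub_le_add_sq hC ht (half_pos hε)
  have hlim : Tendsto (fun n : ℕ+ => D * t / ((n : ℕ) : ℝ)) atTop (𝓝 0) :=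
    (tendsto_const_div_atTop_nhds_zero_nat (D * t)).comp tendsto_PNat_val_atTop_atTop
  filter_upwards [hlim.eventually_lt_const (half_pos hε)] with n hn
  have hn0 : (0 : ℝ) < ((n : ℕ) : ℝ) := by exact_mod_cast n.pos
  set x : ℝ := ((n : ℕ) : ℝ) * t with hx
  have hx0 : 0 ≤ x := by positivity
  have hw := hasSum_poisson_weight x
  have hw0 : ∀ k : ℕ, 0 ≤ Real.exp (-x) * x ^ k / (Nat.factorial k : ℝ) := fun k => by positivity
  have hfs : Summable fun k : ℕ => f ((k : ℝ) / ((n : ℕ) : ℝ)) *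
      (Real.exp (-x) * x ^ k / (Nat.factorial k : ℝ)) := by
    refine Summable.of_norm_bounded (hw.summable.mul_left C) fun k => ?_
    rw [norm_mul, Real.norm_eq_abs, Real.norm_of_nonneg (hw0 k)]
    exact mul_le_mul_of_nonneg_right (hC _ (Set.mem_Ici.2 (by positivity))) (hw0 k)
  have hd := hfs.hasSum.sub (hw.mul_left (f t))
  have hb := (hw.mul_left (ε / 2)).add
    ((hasSum_poisson_variance x).mul_left (D / ((n : ℕ) : ℝ) ^ 2))
  have hle := hd.norm_le_of_bounded hb fun k => ?_
  · rw [dist_eq_norm]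
    have hval : D / ((n : ℕ) : ℝ) ^ 2 * x = D * t / ((n : ℕ) : ℝ) := by
      rw [hx]
      field_simp
    rw [hval, mul_one, mul_one] at hle
    linarith
  · rw [← sub_mul, norm_mul, Real.norm_eq_abs, Real.norm_of_nonneg (hw0 k), ← mul_assoc, ← add_mul]
    refine mul_le_mul_of_nonneg_right
      ((hD _ (Set.mem_Ici.2 (by positivity))).trans_eq ?_) (hw0 k)
    rw [hx]
    field_simp
end

section
/- Let f : [0,∞) → ℝ be a bounded function and let t ≥ 0 be a point at which f is continuous. Then the Baskakov operators converge at t: lim_{n→∞} (𝖡_n f)(t) = f(t), where (𝖡_n f)(t) = ∑_{k=0}^∞ f(k/n) C(n+k−1, k) t^k / (1+t)^{n+k}. -/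
open Filter Topology

/-- The weight `C(n+k-1,k) t^k / (1+t)^(n+k)` of the Baskakov operator. -/
noncomputable def baskakovWeight (t : ℝ) (n k : ℕ) : ℝ :=
  (Nat.choose (n + k - 1) k : ℝ) * t ^ k / (1 + t) ^ (n + k)

lemma baskakovWeight_nonneg {t : ℝ} (ht : 0 ≤ t) (n k : ℕ) : 0 ≤ baskakovWeight t n k := by
  unfold baskakovWeight
  positivity

lemma hasSum_baskakovWeight {t : ℝ} (ht : 0 ≤ t) {n : ℕ} (hn : 0 < n) :
    HasSum (baskakovWeight t n) 1 := by
  obtain ⟨m, rfl⟩ := Nat.exists_eq_succ_of_ne_zero hn.ne'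
  have h1 : (1 + t) ≠ 0 := by positivity
  have hr : ‖t / (1 + t)‖ < 1 := by
    rw [Real.norm_of_nonneg (by positivity), div_lt_one (by positivity)]
    linarith
  have h := (hasSum_choose_mul_geometric_of_norm_lt_one m hr).div_const ((1 + t) ^ (m + 1))
  have hval : 1 / (1 - t / (1 + t)) ^ (m + 1) / (1 + t) ^ (m + 1) = 1 := by
    have : 1 - t / (1 + t) = (1 + t)⁻¹ := by
      field_simp
      ring
    rw [this, inv_pow]
    field_simp
  rw [hval] at h
  refine h.congr_fun fun k => ?_
  have hc : (m.succ + k - 1).choose k = (k + m).choose m := by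
    rw [show m.succ + k - 1 = k + m by lia, Nat.choose_symm_add]
  rw [baskakovWeight, hc, div_pow, pow_add]
  field_simp

lemma mul_baskakovWeight_succ {t : ℝ} {n : ℕ} (hn : 0 < n) (k : ℕ) :
    ((k + 1 : ℕ) : ℝ) * baskakovWeight t n (k + 1) = n * t * baskakovWeight t (n + 1) k := by
  obtain ⟨m, rfl⟩ := Nat.exists_eq_succ_of_ne_zero hn.ne'
  have hc : (m + 1 + k).choose (k + 1) * (k + 1) = (m + 1 + k).choose k * (m + 1) := by
    rw [Nat.choose_succ_right_eq]
    congr 1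
    lia
  have hc' : ((m + 1 + k).choose (k + 1) : ℝ) * (k + 1) = (m + 1 + k).choose k * (m + 1) := by
    exact_mod_cast hc
  simp only [baskakovWeight, Nat.succ_eq_add_one]
  rw [show m + 1 + (k + 1) - 1 = m + 1 + k by lia, show m + 1 + 1 + k - 1 = m + 1 + k by lia,
    show m + 1 + (k + 1) = m + 1 + 1 + k by lia]
  push_cast
  rw [pow_succ]
  linear_combination (t ^ k * t / (1 + t) ^ (m + 1 + 1 + k)) * hc'

lemma hasSum_mul_baskakovWeight {t : ℝ} (ht : 0 ≤ t) {n : ℕ} (hn : 0 < n) :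
    HasSum (fun k : ℕ => (k : ℝ) * baskakovWeight t n k) (n * t) := by
  rw [← hasSum_nat_add_iff' 1]
  simp only [mul_baskakovWeight_succ hn]
  simpa using (hasSum_baskakovWeight ht n.succ_pos).mul_left (n * t)

lemma hasSum_sq_mul_baskakovWeight {t : ℝ} (ht : 0 ≤ t) {n : ℕ} (hn : 0 < n) :
    HasSum (fun k : ℕ => (k : ℝ) ^ 2 * baskakovWeight t n k)
      (n * t * ((n + 1) * t + 1)) := by
  rw [← hasSum_nat_add_iff' 1]
  have h := ((hasSum_mul_baskakovWeight ht n.succ_pos).add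
    (hasSum_baskakovWeight ht n.succ_pos)).mul_left (n * t)
  simp only [Finset.sum_range_one, Nat.cast_zero, ne_eq, OfNat.ofNat_ne_zero, not_false_eq_true,
    zero_pow, zero_mul, sub_zero]
  push_cast at h
  refine h.congr_fun fun k => ?_
  rw [pow_two, mul_assoc, mul_baskakovWeight_succ hn]
  push_cast
  ring

lemma hasSum_sub_sq_mul_baskakovWeight {t : ℝ} (ht : 0 ≤ t) {n : ℕ} (hn : 0 < n) :
    HasSum (fun k : ℕ => ((k : ℝ) / n - t) ^ 2 * baskakovWeight t n k) (t * (1 + t) / n) := by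
  have hn' : (n : ℝ) ≠ 0 := by positivity
  convert! (((hasSum_sq_mul_baskakovWeight ht hn).mul_left (1 / (n : ℝ) ^ 2)).sub
    ((hasSum_mul_baskakovWeight ht hn).mul_left (2 * t / n))).add
    ((hasSum_baskakovWeight ht hn).mul_left (t ^ 2)) using 1
  · ext k
    field_simp
    ring
  · field_simp
    ring

lemma exists_abs_sub_le_add_mul_sq {f : ℝ → ℝ} {s : Set ℝ} {C t : ℝ}
    (hC : ∀ x ∈ s, |f x| ≤ C) (hts : t ∈ s) (hft : ContinuousWithinAt f s t)
    {ε : ℝ} (hε : 0 < ε) :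
    ∃ M, ∀ x ∈ s, |f x - f t| ≤ ε + M * (x - t) ^ 2 := by
  obtain ⟨δ, hδ, h⟩ := Metric.continuousWithinAt_iff.1 hft ε hε
  have hC0 : 0 ≤ C := (abs_nonneg _).trans (hC t hts)
  refine ⟨2 * C / δ ^ 2, fun x hx => ?_⟩
  rcases lt_or_ge (dist x t) δ with hd | hd
  · have h1 := h hx hd
    rw [Real.dist_eq] at h1
    have : 0 ≤ 2 * C / δ ^ 2 * (x - t) ^ 2 := by positivity
    linarith
  · have h1 : |f x - f t| ≤ 2 * C := by
      have := abs_sub (f x) (f t)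
      linarith [hC x hx, hC t hts]
    have h2 : δ ^ 2 ≤ (x - t) ^ 2 := by
      rw [Real.dist_eq] at hd
      rw [← sq_abs (x - t)]
      gcongr
    have h3 : 2 * C ≤ 2 * C / δ ^ 2 * (x - t) ^ 2 := by
      rw [div_mul_eq_mul_div, le_div_iff₀ (by positivity)]
      gcongr
    linarith

lemma abs_tsum_baskakovWeight_sub_le {f : ℝ → ℝ} {t ε M : ℝ} (ht : 0 ≤ t)
    (hM : ∀ x ∈ Set.Ici (0 : ℝ), |f x - f t| ≤ ε + M * (x - t) ^ 2) {n : ℕ} (hn : 0 < n) :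
    |∑' k : ℕ, f ((k : ℝ) / n) * baskakovWeight t n k - f t| ≤ ε + M * (t * (1 + t) / n) := by
  have hw := hasSum_baskakovWeight ht hn
  have hmaj : HasSum (fun k : ℕ => (ε + M * ((k : ℝ) / n - t) ^ 2) * baskakovWeight t n k)
      (ε + M * (t * (1 + t) / n)) := by
    convert! (hw.mul_left ε).add ((hasSum_sub_sq_mul_baskakovWeight ht hn).mul_left M) using 1
    · ext k
      ring
    · ring
  have hle : ∀ k : ℕ, ‖(f ((k : ℝ) / n) - f t) * baskakovWeight t n k‖ ≤
      (ε + M * ((k : ℝ) / n - t) ^ 2) * baskakovWeight t n k := fun k => by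
    rw [norm_mul, Real.norm_of_nonneg (baskakovWeight_nonneg ht n k)]
    exact mul_le_mul_of_nonneg_right (hM _ (Set.mem_Ici.2 (by positivity)))
      (baskakovWeight_nonneg ht n k)
  have hs := (Summable.of_norm_bounded hmaj.summable hle).hasSum
  have hf : HasSum (fun k : ℕ => f ((k : ℝ) / n) * baskakovWeight t n k)
      (∑' k : ℕ, (f ((k : ℝ) / n) - f t) * baskakovWeight t n k + f t) := by
    convert! hs.add (hw.mul_left (f t)) using 1
    · ext k
      ring
    · ring
  rw [hf.tsum_eq, add_sub_cancel_right]
  exact tsum_of_norm_bounded hmaj hle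

/-- If `f : [0,∞) → ℝ` is bounded and continuous at `t ≥ 0`, then the
Baskakov operators converge at `t`:
`lim_{n→∞} (𝖡_n f)(t) = f(t)` with `(𝖡_n f)(t) = ∑_k f(k/n) C(n+k−1,k) t^k / (1+t)^{n+k}`. -/
theorem stmt_14 (f : ℝ → ℝ) (hfb : ∃ C, ∀ t ∈ Set.Ici (0 : ℝ), |f t| ≤ C)
    (t : ℝ) (ht : 0 ≤ t) (hft : ContinuousWithinAt f (Set.Ici 0) t) :
    Tendsto (fun n : ℕ+ =>
        ∑' k : ℕ, f ((k : ℝ) / ((n : ℕ) : ℝ)) *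
          ((Nat.choose ((n : ℕ) + k - 1) k : ℝ) * t ^ k / (1 + t) ^ ((n : ℕ) + k)))
      atTop (𝓝 (f t)) := by
  obtain ⟨C, hC⟩ := hfb
  rw [Metric.tendsto_nhds]
  intro ε hε
  obtain ⟨M, hM⟩ := exists_abs_sub_le_add_mul_sq hC ht hft (half_pos hε)
  have hcast : Tendsto (fun n : ℕ+ => ((n : ℕ) : ℝ)) atTop atTop :=
    tendsto_natCast_atTop_atTop.comp tendsto_PNat_val_atTop_atTop
  have hlim : Tendsto (fun n : ℕ+ => ε / 2 + M * (t * (1 + t) / ((n : ℕ) : ℝ))) atTop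
      (𝓝 (ε / 2)) := by
    simpa using ((hcast.const_div_atTop (t * (1 + t))).const_mul M).const_add (ε / 2)
  filter_upwards [hlim.eventually_lt_const (half_lt_self hε)] with n hn
  exact (abs_tsum_baskakovWeight_sub_le ht hM n.pos).trans_lt hn
end
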